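/- arXiv:2101.03992 — 3 statements merged into one kernel-verified Lean document; each statement's English description precedes it below -/
import Mathlib

section
/- Let p≥1 be an integer and let g_1,…,g_p:[0,1]→ℝ be continuous functions with g_i(0)=0 and g_i(1)≥1 for all i∈{1,…,p}. Then there exist a permutation π of {1,…,p} and times 0=s_1<s_2<…<s_{p+1}≤1 such that for every i∈{1,…,p}, g_{π(i)}(s_{i+1}) − g_{π(i)}(s_i) ≥ 1/p. -/
theorem greedy_aux (c : ℝ) (hc : 0 < c) (b : ℝ) : ∀ (n : ℕ) (a : ℝ) (_ : a ≤ b) (g : Fin n → ℝ → ℝ)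
    (_ : ∀ i, ContinuousOn (g i) (Set.Icc a b)) (_ : ∀ i, n * c ≤ g i b - g i a),
    ∃ (e : Fin n → Fin n) (s : Fin (n + 1) → ℝ), Function.Injective e ∧
      s 0 = a ∧ StrictMono s ∧ s (Fin.last n) ≤ b ∧
      ∀ i : Fin n, c ≤ g (e i) (s i.succ) - g (e i) (s i.castSucc) := by
  intro n
  induction n with
  | zero =>
    intro a hab g _ _
    exact ⟨id, fun _ => a, Function.injective_id, rfl, fun i j h => by omega, hab,
      fun i => i.elim0⟩
  | succ n ih =>
    intro a hab g hg hb
    let S : Set ℝ := ⋃ i, (Set.Icc a b ∩ g i ⁻¹' Set.Ici (c + g i a))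
    have hSc : IsClosed S := isClosed_iUnion_of_finite fun i =>
      (hg i).preimage_isClosed_of_isClosed isClosed_Icc isClosed_Ici
    have hbS : b ∈ S := by
      refine Set.mem_iUnion.2 ⟨0, ⟨hab, le_rfl⟩, ?_⟩
      have h := hb 0
      push_cast at h
      have : 0 ≤ (n : ℝ) * c := by positivity
      simp only [Set.mem_preimage, Set.mem_Ici]
      linarith
    have hbd : BddBelow S := ⟨a, fun x hx => by
      obtain ⟨i, hi, _⟩ := Set.mem_iUnion.1 hx
      exact hi.1⟩
    have htS : sInf S ∈ S := hSc.csInf_mem ⟨b, hbS⟩ hbd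
    have hmin : ∀ x ∈ S, sInf S ≤ x := fun x hx => csInf_le hbd hx
    generalize sInf S = t at htS hmin
    obtain ⟨i0, ⟨hat, htb⟩, hi0⟩ := Set.mem_iUnion.1 htS
    simp only [Set.mem_preimage, Set.mem_Ici] at hi0
    have hlt : a < t := by
      rcases hat.eq_or_lt with h | h
      · rw [← h] at hi0; linarith
      · exact h
    have hle : ∀ j, g j t - g j a ≤ c := by
      intro j
      by_contra! hj
      obtain ⟨x, hx, hxe⟩ := intermediate_value_Ioo hat
        ((hg j).mono (Set.Icc_subset_Icc le_rfl htb))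
        (show c + g j a ∈ Set.Ioo (g j a) (g j t) from ⟨by linarith, by linarith⟩)
      have := hmin x (Set.mem_iUnion.2 ⟨j, ⟨hx.1.le, hx.2.le.trans htb⟩, hxe.ge⟩)
      exact absurd hx.2 this.not_gt
    obtain ⟨e, s, he, hs0, hsm, hsl, hinc⟩ := ih t htb (fun j => g (i0.succAbove j))
      (fun j => (hg _).mono (Set.Icc_subset_Icc hat le_rfl))
      (fun j => by
        have h := hb (i0.succAbove j)
        have h' := hle (i0.succAbove j)
        push_cast at h
        linarith)
    refine ⟨Fin.cons i0 (fun j => i0.succAbove (e j)), Fin.cons a s, ?_, rfl, ?_, ?_, ?_⟩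
    · rw [Fin.cons_injective_iff]
      refine ⟨?_, Fin.succAbove_right_injective.comp he⟩
      rintro ⟨j, hj⟩
      exact Fin.succAbove_ne _ _ hj
    · rw [Fin.strictMono_iff_lt_succ]
      intro i
      refine Fin.cases ?_ (fun j => ?_) i
      · simpa [hs0] using hlt
      · rw [← Fin.succ_castSucc, Fin.cons_succ, Fin.cons_succ]
        exact hsm Fin.castSucc_lt_succ
    · rw [← Fin.succ_last, Fin.cons_succ]; exact hsl
    · intro i
      refine Fin.cases ?_ (fun j => ?_) i
      · simp only [Fin.cons_succ, Fin.cons_zero, Fin.castSucc_zero, hs0]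
        linarith
      · rw [← Fin.succ_castSucc, Fin.cons_succ, Fin.cons_succ, Fin.cons_succ]
        exact hinc j

/-- Sublemma 2.1 (1): given continuous `g₁,…,g_p : [0,1] → ℝ` with `gᵢ(0) = 0` and
`gᵢ(1) ≥ 1`, there are a permutation `π` of `{1,…,p}` and times `0 = s₁ < … < s_{p+1} ≤ 1`
such that `g_{π(i)}(s_{i+1}) - g_{π(i)}(s_i) ≥ 1/p` for every `i`. -/
theorem stmt_6 (p : ℕ) (hp : 1 ≤ p) (g : Fin p → ℝ → ℝ)
    (hcont : ∀ i, ContinuousOn (g i) (Set.Icc 0 1))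
    (h0 : ∀ i, g i 0 = 0) (h1 : ∀ i, 1 ≤ g i 1) :
    ∃ (π : Equiv.Perm (Fin p)) (s : Fin (p + 1) → ℝ),
      s 0 = 0 ∧ StrictMono s ∧ s (Fin.last p) ≤ 1 ∧
      ∀ i : Fin p, (1 : ℝ) / p ≤ g (π i) (s i.succ) - g (π i) (s i.castSucc) := by

  have hp' : (0 : ℝ) < p := by exact_mod_cast hp
  obtain ⟨e, s, he, h⟩ := greedy_aux (1 / p) (by positivity) 1 p 0 zero_le_one g hcont
    (fun i => by
      rw [h0 i, mul_one_div_cancel hp'.ne']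
      linarith [h1 i])
  exact ⟨Equiv.ofBijective e (Finite.injective_iff_bijective.1 he), s, h⟩
end

section
/- Let X be a real random variable whose law has cumulative distribution function F and lies in the strong attraction domain of a Cauchy distribution. For k>0 write (x)_k = max(min(x,k),−k). Then the three limits lim_{N→∞} N·E[sin(X/N)], lim_{k→∞} E[X·1_{|X|≤k}], and lim_{k→∞} E[(X)_k] all exist, are equal, and equal ∫₀^∞ (1 − F(x) − F(−x)) dx. -/
open MeasureTheory Filter Asymptotics

noncomputable section

/-- A probability measure `μ` on `ℝ` lies in the strong attraction domain of a Cauchy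
distribution: for some scale `σ ≥ 0` and some `δ > 0`, its CDF `F` satisfies
`F(x) = σ/(π|x|) + o(|x|^(-1-δ))` at `-∞` and `1 - F(x) = σ/(πx) + o(x^(-1-δ))` at `+∞`. -/
def StrongCauchyDomain (μ : Measure ℝ) : Prop :=
  IsProbabilityMeasure μ ∧ ∃ σ : ℝ, 0 ≤ σ ∧ ∃ δ : ℝ, 0 < δ ∧
    (fun x : ℝ => (μ (Set.Iic x)).toReal - σ / (Real.pi * |x|))
      =o[atBot] (fun x : ℝ => |x| ^ (-(1 + δ))) ∧
    (fun x : ℝ => (1 - (μ (Set.Iic x)).toReal) - σ / (Real.pi * x))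
      =o[atTop] (fun x : ℝ => x ^ (-(1 + δ)))

lemma clip_repr (φ φ' : ℝ → ℝ) (hd : ∀ x, HasDerivAt φ (φ' x) x) (hc : Continuous φ')
    (hodd : ∀ x, φ (-x) = -φ x) (k : ℝ) (hk : 0 ≤ k) (x : ℝ) :
    ∫ t in Set.Ioc 0 k, φ' t * ((if t < x then 1 else 0) - (if x ≤ -t then 1 else 0))
      = φ (max (min x k) (-k)) := by
  have h0 : φ 0 = 0 := by have := hodd 0; simp at this; linarith
  have key : ∀ y, 0 ≤ y → ∫ t in Set.Ioc 0 k, (Set.Iic y).indicator φ' t = φ (min y k) := by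
    intro y hy
    rw [setIntegral_indicator measurableSet_Iic, Set.Ioc_inter_Iic, min_comm k y,
      ← intervalIntegral.integral_of_le (le_min hy hk),
      intervalIntegral.integral_eq_sub_of_hasDerivAt (fun x _ => hd x)
        (hc.intervalIntegrable _ _), h0, sub_zero]
  rcases le_or_gt 0 x with hx | hx
  · rw [max_eq_left (by have := le_min hx hk; linarith), ← key x hx]
    apply setIntegral_congr_ae measurableSet_Ioc
    have : ∀ᵐ t : ℝ, t ≠ x := by simp [ae_iff]
    filter_upwards [this] with t ht htk
    have h1 : ¬ (x ≤ -t) := by have := htk.1; linarith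
    by_cases h2 : t < x
    · simp [h1, h2, h2.le]
    · have : ¬ t ≤ x := fun h => h2 (lt_of_le_of_ne h ht)
      simp [h1, h2, this]
  · have e : max (min x k) (-k) = - min (-x) k := by
      rw [min_eq_left (by linarith), ← max_neg_neg, neg_neg]
    rw [e, hodd, ← key (-x) (by linarith), ← integral_neg]
    apply setIntegral_congr_fun measurableSet_Ioc
    intro t ht
    have h1 : ¬ t < x := by have := ht.1; linarith
    by_cases h2 : x ≤ -t
    · have : t ≤ -x := by linarith
      simp [h1, h2, this]
    · have : ¬ t ≤ -x := fun h => h2 (by linarith)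
      simp [h1, h2, this]

lemma clip_integral (μ : Measure ℝ) [IsProbabilityMeasure μ]
    (φ φ' : ℝ → ℝ) (hd : ∀ x, HasDerivAt φ (φ' x) x) (hc : Continuous φ')
    (hodd : ∀ x, φ (-x) = -φ x) (k : ℝ) (hk : 0 ≤ k) :
    ∫ x, φ (max (min x k) (-k)) ∂μ = ∫ t in Set.Ioc 0 k,
      φ' t * (1 - (μ (Set.Iic t)).toReal - (μ (Set.Iic (-t))).toReal) := by
  simp_rw [← clip_repr φ φ' hd hc hodd k hk]
  have hint : Integrable (Function.uncurry fun (x t : ℝ) =>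
      φ' t * ((if t < x then (1:ℝ) else 0) - (if x ≤ -t then 1 else 0)))
      (μ.prod (volume.restrict (Set.Ioc 0 k))) := by
    have hb : Integrable φ' (volume.restrict (Set.Ioc 0 k)) :=
      (hc.continuousOn.integrableOn_compact isCompact_Icc).mono_set Set.Ioc_subset_Icc_self
    refine Integrable.mono (hb.comp_snd μ) ?_ ?_
    · apply Measurable.aestronglyMeasurable
      unfold Function.uncurry
      refine (hc.measurable.comp measurable_snd).mul (Measurable.sub ?_ ?_)
      · exact Measurable.ite (measurableSet_lt measurable_snd measurable_fst)
          measurable_const measurable_const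
      · exact Measurable.ite (measurableSet_le measurable_fst measurable_snd.neg)
          measurable_const measurable_const
    · refine ae_of_all _ fun p => ?_
      simp only [Function.uncurry, norm_mul]
      refine mul_le_of_le_one_right (norm_nonneg _) ?_
      split_ifs <;> simp
  rw [integral_integral_swap hint]
  congr 1
  ext t
  rw [integral_const_mul]
  congr 1
  have e1 : (fun x : ℝ => if t < x then (1:ℝ) else 0) = (Set.Ioi t).indicator 1 := by
    ext x; simp [Set.indicator_apply]
  have e2 : (fun x : ℝ => if x ≤ -t then (1:ℝ) else 0) = (Set.Iic (-t)).indicator 1 := by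
    ext x; simp [Set.indicator_apply]
  have i1 : Integrable ((Set.Ioi t).indicator (1 : ℝ → ℝ)) μ :=
    (integrable_const (1:ℝ)).indicator measurableSet_Ioi
  have i2 : Integrable ((Set.Iic (-t)).indicator (1 : ℝ → ℝ)) μ :=
    (integrable_const (1:ℝ)).indicator measurableSet_Iic
  rw [integral_sub (by rw [e1]; exact i1) (by rw [e2]; exact i2), e1, e2,
    integral_indicator_one measurableSet_Ioi, integral_indicator_one measurableSet_Iic,
    ← Set.compl_Iic, probReal_compl_eq_one_sub measurableSet_Iic]
  rfl

lemma g_meas (μ : Measure ℝ) [IsProbabilityMeasure μ] :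
    Measurable fun t : ℝ => 1 - (μ (Set.Iic t)).toReal - (μ (Set.Iic (-t))).toReal := by
  have h : Measurable fun t : ℝ => (μ (Set.Iic t)).toReal := by
    apply Monotone.measurable
    intro a b hab
    exact ENNReal.toReal_mono (measure_ne_top _ _) (measure_mono (Set.Iic_subset_Iic.2 hab))
  exact (measurable_const.sub h).sub (h.comp measurable_neg)

lemma isLittleO_mul_tendsto (δ : ℝ) (hδ : 0 < δ) (f : ℝ → ℝ) (h : f =o[atTop] fun x : ℝ => x ^ (-(1 + δ))) :
    Tendsto (fun x => x * f x) atTop (nhds 0) := by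
  have h1 : (fun x => x * f x) =O[atTop] fun x : ℝ => x ^ (-δ) := by
    have := (isBigO_refl (fun x : ℝ => x) atTop).mul h.isBigO
    refine this.congr' EventuallyEq.rfl ?_
    filter_upwards [eventually_gt_atTop 0] with x hx
    rw [← Real.rpow_one_add' hx.le (by linarith)]
    congr 1; ring
  exact h1.trans_tendsto (tendsto_rpow_neg_atTop hδ)

lemma facts (μ : Measure ℝ) [IsProbabilityMeasure μ] (σ δ : ℝ) (hδ : 0 < δ)
    (h1 : (fun x : ℝ => (μ (Set.Iic x)).toReal - σ / (Real.pi * |x|))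
      =o[atBot] (fun x : ℝ => |x| ^ (-(1 + δ))))
    (h2 : (fun x : ℝ => (1 - (μ (Set.Iic x)).toReal) - σ / (Real.pi * x))
      =o[atTop] (fun x : ℝ => x ^ (-(1 + δ)))) :
    IntegrableOn (fun t : ℝ => 1 - (μ (Set.Iic t)).toReal - (μ (Set.Iic (-t))).toReal) (Set.Ioi 0)
    ∧ Tendsto (fun k : ℝ => k * (1 - (μ (Set.Iic k)).toReal)) atTop (nhds (σ / Real.pi))
    ∧ Tendsto (fun k : ℝ => k * (μ (Set.Iic (-k))).toReal) atTop (nhds (σ / Real.pi)) := by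
  have h1' : (fun x : ℝ => (μ (Set.Iic (-x))).toReal - σ / (Real.pi * x))
      =o[atTop] (fun x : ℝ => x ^ (-(1 + δ))) := by
    refine (h1.comp_tendsto tendsto_neg_atTop_atBot).congr' ?_ ?_ <;>
    · filter_upwards [eventually_gt_atTop 0] with x hx
      simp [abs_of_pos hx]
  refine ⟨?_, ?_, ?_⟩
  · have hO := (h2.sub h1').isBigO
    have hO' : (fun t : ℝ => 1 - (μ (Set.Iic t)).toReal - (μ (Set.Iic (-t))).toReal)
        =O[atTop] (fun x : ℝ => x ^ (-(1 + δ))) := hO.congr_left (fun x => by ring)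
    refine IntegrableOn.mono_set (t := Set.Ici 0) ?_ Set.Ioi_subset_Ici_self
    refine LocallyIntegrableOn.integrableOn_of_isBigO_atTop ?_ hO'
      (integrableAtFilter_rpow_atTop_iff.2 (by linarith))
    apply LocallyIntegrable.locallyIntegrableOn
    refine (locallyIntegrable_const (1:ℝ)).mono (g_meas μ).aestronglyMeasurable ?_
    refine ae_of_all _ fun t => ?_
    have a1 : (μ (Set.Iic t)).toReal ≤ 1 := measureReal_le_one
    have a2 : (μ (Set.Iic (-t))).toReal ≤ 1 := measureReal_le_one
    have a3 : 0 ≤ (μ (Set.Iic t)).toReal := ENNReal.toReal_nonneg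
    have a4 : 0 ≤ (μ (Set.Iic (-t))).toReal := ENNReal.toReal_nonneg
    rw [Real.norm_eq_abs, norm_one, abs_le]
    constructor <;> linarith
  · have := (isLittleO_mul_tendsto δ hδ _ h2).add_const (σ / Real.pi)
    rw [zero_add] at this
    refine this.congr' ?_
    filter_upwards [eventually_gt_atTop 0] with x hx
    have := Real.pi_ne_zero
    field_simp
    ring
  · have := (isLittleO_mul_tendsto δ hδ _ h1').add_const (σ / Real.pi)
    rw [zero_add] at this
    refine this.congr' ?_
    filter_upwards [eventually_gt_atTop 0] with x hx
    have := Real.pi_ne_zero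
    field_simp
    ring

lemma clip_meas (k : ℝ) : Continuous fun x : ℝ => max (min x k) (-k) := by fun_prop

lemma trunc_integral (μ : Measure ℝ) [IsProbabilityMeasure μ] (k : ℝ) (hk : 0 < k) :
    ∫ x, (if |x| ≤ k then x else 0) ∂μ = ∫ x, max (min x k) (-k) ∂μ
      - k * (1 - (μ (Set.Iic k)).toReal) + k * (μ (Set.Iio (-k))).toReal := by
  have i0 : Integrable (fun x : ℝ => max (min x k) (-k)) μ := by
    refine (integrable_const k).mono' (clip_meas k).aestronglyMeasurable (ae_of_all _ fun x => ?_)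
    rw [Real.norm_eq_abs, abs_le]
    exact ⟨le_max_right _ _, max_le (min_le_right _ _) (by linarith)⟩
  have i1 : Integrable ((Set.Ioi k).indicator (1 : ℝ → ℝ)) μ :=
    (integrable_const (1:ℝ)).indicator measurableSet_Ioi
  have i2 : Integrable ((Set.Iio (-k)).indicator (1 : ℝ → ℝ)) μ :=
    (integrable_const (1:ℝ)).indicator measurableSet_Iio
  have e : (fun x : ℝ => if |x| ≤ k then x else 0) = fun x => max (min x k) (-k)
      - k * (Set.Ioi k).indicator (1 : ℝ → ℝ) x + k * (Set.Iio (-k)).indicator (1 : ℝ → ℝ) x := by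
    ext x
    simp only [Set.indicator_apply, Set.mem_Ioi, Set.mem_Iio, Pi.one_apply]
    rcases lt_or_ge k x with h | h
    · have : ¬ x < -k := by linarith
      have h3 : ¬ |x| ≤ k := fun h' => by have := (abs_le.1 h').2; linarith
      simp [h, this, h3, min_eq_right h.le, hk.le]
    · rcases lt_or_ge x (-k) with h4 | h4
      · have h3 : ¬ |x| ≤ k := fun h' => by have := (abs_le.1 h').1; linarith
        simp [not_lt.2 h, h4, h3, min_eq_left h, max_eq_right h4.le]
      · simp [not_lt.2 h, not_lt.2 h4, abs_le.2 ⟨h4, h⟩, min_eq_left h, max_eq_left h4]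
  have i3 : Integrable (fun x : ℝ => max (min x k) (-k)
      - k * (Set.Ioi k).indicator (1 : ℝ → ℝ) x) μ := i0.sub (i1.const_mul k)
  rw [e, integral_add i3 (i2.const_mul k), integral_sub i0 (i1.const_mul k),
    integral_const_mul, integral_const_mul, integral_indicator_one measurableSet_Ioi,
    integral_indicator_one measurableSet_Iio, ← Set.compl_Iic,
    probReal_compl_eq_one_sub measurableSet_Iic]
  rfl

lemma sin_err (μ : Measure ℝ) [IsProbabilityMeasure μ] (a k : ℝ) (hk : 0 < k) :
    |∫ x, Real.sin (x / a) ∂μ - ∫ x, Real.sin (max (min x k) (-k) / a) ∂μ| ≤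
      2 * ((1 - (μ (Set.Iic k)).toReal) + (μ (Set.Iic (-k))).toReal) := by
  have j1 : Integrable (fun x : ℝ => Real.sin (x / a)) μ := by
    refine (integrable_const (1:ℝ)).mono' (by fun_prop) (ae_of_all _ fun x => ?_)
    exact Real.abs_sin_le_one _
  have j2 : Integrable (fun x : ℝ => Real.sin (max (min x k) (-k) / a)) μ := by
    refine (integrable_const (1:ℝ)).mono' (by fun_prop) (ae_of_all _ fun x => ?_)
    exact Real.abs_sin_le_one _
  have i1 : Integrable ((Set.Ioi k).indicator (1 : ℝ → ℝ)) μ :=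
    (integrable_const (1:ℝ)).indicator measurableSet_Ioi
  have i2 : Integrable ((Set.Iic (-k)).indicator (1 : ℝ → ℝ)) μ :=
    (integrable_const (1:ℝ)).indicator measurableSet_Iic
  have hI : ∫ x, 2 * ((Set.Ioi k).indicator (1 : ℝ → ℝ) x + (Set.Iic (-k)).indicator (1 : ℝ → ℝ) x) ∂μ
     = 2 * ((1 - (μ (Set.Iic k)).toReal) + (μ (Set.Iic (-k))).toReal) := by
    rw [integral_const_mul, integral_add i1 i2, integral_indicator_one measurableSet_Ioi,
      integral_indicator_one measurableSet_Iic, ← Set.compl_Iic,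
      probReal_compl_eq_one_sub measurableSet_Iic]
    rfl
  rw [← integral_sub j1 j2, ← hI, ← Real.norm_eq_abs]
  refine norm_integral_le_of_norm_le ((i1.add i2).const_mul 2) (ae_of_all _ fun x => ?_)
  have b : |Real.sin (x / a) - Real.sin (max (min x k) (-k) / a)| ≤ 2 := by
    refine (abs_sub _ _).trans ?_
    linarith [Real.abs_sin_le_one (x / a), Real.abs_sin_le_one (max (min x k) (-k) / a)]
  rw [Real.norm_eq_abs]
  simp only [Set.indicator_apply, Set.mem_Ioi, Set.mem_Iic, Pi.one_apply]
  rcases lt_or_ge k x with h | h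
  · have : ¬ x ≤ -k := by linarith
    simpa [h, this] using b
  · rcases le_or_gt x (-k) with h4 | h4
    · simpa [not_lt.2 h, h4] using b
    · simp [not_lt.2 h, not_le.2 h4, min_eq_left h, max_eq_left h4.le]

theorem core (μ : Measure ℝ) [IsProbabilityMeasure μ] (σ δ : ℝ) (hδ : 0 < δ)
    (h1 : (fun x : ℝ => (μ (Set.Iic x)).toReal - σ / (Real.pi * |x|))
      =o[atBot] (fun x : ℝ => |x| ^ (-(1 + δ))))
    (h2 : (fun x : ℝ => (1 - (μ (Set.Iic x)).toReal) - σ / (Real.pi * x))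
      =o[atTop] (fun x : ℝ => x ^ (-(1 + δ)))) :
    ∃ L : ℝ,
      Tendsto (fun N : ℕ => (N : ℝ) * ∫ x, Real.sin (x / N) ∂μ) atTop (nhds L) ∧
      Tendsto (fun k : ℝ => ∫ x, (if |x| ≤ k then x else 0) ∂μ) atTop (nhds L) ∧
      Tendsto (fun k : ℝ => ∫ x, max (min x k) (-k) ∂μ) atTop (nhds L) ∧
      L = ∫ x in Set.Ioi (0 : ℝ),
            (1 - (μ (Set.Iic x)).toReal - (μ (Set.Iic (-x))).toReal) := by
  obtain ⟨hg, hG, hF⟩ := facts μ σ δ hδ h1 h2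
  set g : ℝ → ℝ := fun x => 1 - (μ (Set.Iic x)).toReal - (μ (Set.Iic (-x))).toReal with hgdef
  have T3 : Tendsto (fun k : ℝ => ∫ x, max (min x k) (-k) ∂μ) atTop
      (nhds (∫ x in Set.Ioi (0 : ℝ), g x)) := by
    refine (intervalIntegral_tendsto_integral_Ioi 0 hg tendsto_id).congr' ?_
    filter_upwards [eventually_ge_atTop 0] with k hk
    have := clip_integral μ (fun x => x) (fun _ => 1) (fun x => hasDerivAt_id x)
      continuous_const (fun x => rfl) k hk
    rw [this, id, intervalIntegral.integral_of_le hk]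
    simp [hgdef]
  refine ⟨∫ x in Set.Ioi (0 : ℝ), g x, ?_, ?_, T3, rfl⟩
  · -- sine
    have hsq : Tendsto (fun N : ℕ => (N:ℝ)^2) atTop atTop :=
      (tendsto_pow_atTop two_ne_zero).comp tendsto_natCast_atTop_atTop
    have A : Tendsto (fun N : ℕ => (N : ℝ) *
        ∫ x, Real.sin (max (min x ((N:ℝ)^2)) (-((N:ℝ)^2)) / N) ∂μ) atTop
        (nhds (∫ x in Set.Ioi (0 : ℝ), g x)) := by
      have D : Tendsto (fun N : ℕ => ∫ x in Set.Ioi (0:ℝ),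
          (Set.Iic ((N:ℝ)^2)).indicator (fun t => Real.cos (t / N) * g t) x) atTop
          (nhds (∫ x in Set.Ioi (0 : ℝ), g x)) := by
        refine tendsto_integral_filter_of_dominated_convergence (fun x => ‖g x‖) ?_ ?_ hg.norm ?_
        · refine Eventually.of_forall fun N => ?_
          refine (Measurable.indicator ?_ measurableSet_Iic).aestronglyMeasurable
          exact Measurable.mul (by fun_prop) (g_meas μ)
        · refine Eventually.of_forall fun N => ae_of_all _ fun x => ?_
          refine (norm_indicator_le_norm_self _ _).trans ?_
          rw [norm_mul]
          exact mul_le_of_le_one_left (norm_nonneg _) (Real.abs_cos_le_one _)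
        · refine ae_of_all _ fun x => ?_
          have c : Tendsto (fun N : ℕ => Real.cos (x / N) * g x) atTop (nhds (g x)) := by
            have : Tendsto (fun N : ℕ => x / (N:ℝ)) atTop (nhds 0) :=
              tendsto_const_div_atTop_nhds_zero_nat x
            have := ((Real.continuous_cos.tendsto 0).comp this).mul_const (g x)
            simpa using this
          refine c.congr' ?_
          filter_upwards [hsq.eventually_ge_atTop x] with N hN
          rw [Set.indicator_of_mem (Set.mem_Iic.2 hN)]
      refine D.congr' ?_
      filter_upwards [eventually_gt_atTop 0] with N hN
      have hN' : (0:ℝ) < N := by exact_mod_cast hN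
      have := clip_integral μ (fun x => N * Real.sin (x / N)) (fun x => Real.cos (x / N))
        (fun x => by
          have := (((hasDerivAt_id x).div_const (N:ℝ)).sin).const_mul (N:ℝ)
          refine this.congr_deriv ?_
          rw [mul_one_div, mul_div_cancel₀ _ hN'.ne', id])
        (by fun_prop) (fun x => by simp [neg_div]) ((N:ℝ)^2) (by positivity)
      rw [← integral_const_mul, this, setIntegral_indicator measurableSet_Iic, Set.Ioi_inter_Iic]
    have B : Tendsto (fun N : ℕ => (N : ℝ) * ∫ x, Real.sin (x / N) ∂μ - (N : ℝ) *
        ∫ x, Real.sin (max (min x ((N:ℝ)^2)) (-((N:ℝ)^2)) / N) ∂μ) atTop (nhds 0) := by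
      have hb : Tendsto (fun N : ℕ => (2 / (N:ℝ)) * ((N:ℝ)^2 * (1 - (μ (Set.Iic ((N:ℝ)^2))).toReal)
          + (N:ℝ)^2 * (μ (Set.Iic (-((N:ℝ)^2)))).toReal)) atTop (nhds 0) := by
        have := (tendsto_const_div_atTop_nhds_zero_nat (2:ℝ)).mul
          ((hG.comp hsq).add (hF.comp hsq))
        simpa using this
      refine squeeze_zero_norm' ?_ hb
      filter_upwards [eventually_gt_atTop 0] with N hN
      have hN' : (0:ℝ) < N := by exact_mod_cast hN
      have := sin_err μ N ((N:ℝ)^2) (by positivity)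
      rw [← mul_sub, norm_mul, Real.norm_eq_abs, Real.norm_eq_abs, abs_of_pos hN']
      refine (mul_le_mul_of_nonneg_left this hN'.le).trans (le_of_eq ?_)
      field_simp
    simpa using B.add A
  · -- truncation
    have hF2 : Tendsto (fun k : ℝ => k * (μ (Set.Iic (-(k+1)))).toReal) atTop
        (nhds (σ / Real.pi)) := by
      have t1 : Tendsto (fun k : ℝ => k + 1) atTop atTop := tendsto_atTop_add_const_right _ _ tendsto_id
      have a := hF.comp t1
      have b : Tendsto (fun k : ℝ => k / (k + 1)) atTop (nhds 1) := by
        have : Tendsto (fun k : ℝ => 1 - (k+1)⁻¹) atTop (nhds (1 - 0)) :=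
          tendsto_const_nhds.sub (tendsto_inv_atTop_zero.comp t1)
        rw [sub_zero] at this
        refine this.congr' ?_
        filter_upwards [eventually_gt_atTop 0] with k hk
        field_simp
        ring
      have := b.mul a
      rw [one_mul] at this
      refine this.congr' ?_
      filter_upwards [eventually_gt_atTop 0] with k hk
      simp only [Function.comp]
      field_simp
    have hF3 : Tendsto (fun k : ℝ => k * (μ (Set.Iio (-k))).toReal) atTop
        (nhds (σ / Real.pi)) := by
      refine tendsto_of_tendsto_of_tendsto_of_le_of_le' hF2 hF ?_ ?_ <;>
      · filter_upwards [eventually_gt_atTop 0] with k hk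
        refine mul_le_mul_of_nonneg_left ?_ hk.le
        refine ENNReal.toReal_mono (measure_ne_top _ _) (measure_mono ?_)
        intro x hx
        simp only [Set.mem_Iic, Set.mem_Iio] at *
        linarith
    have := (T3.sub hG).add hF3
    rw [sub_add_cancel] at this
    refine this.congr' ?_
    filter_upwards [eventually_gt_atTop 0] with k hk
    rw [trunc_integral μ k hk]

/-- Lemma 5.2: for a random variable `X` whose law lies in the strong attraction domain of a
Cauchy distribution, the limits `lim_N N·E[sin(X/N)]`, `lim_k E[X·1_{|X|≤k}]` and
`lim_k E[(X)_k]` all exist, coincide, and equal `∫₀^∞ (1 - F(x) - F(-x)) dx`. -/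
theorem stmt_14 {Ω : Type*} [MeasurableSpace Ω] (P : Measure Ω) [IsProbabilityMeasure P]
    (X : Ω → ℝ) (hX : Measurable X) (hdom : StrongCauchyDomain (P.map X)) :
    ∃ L : ℝ,
      Tendsto (fun N : ℕ => (N : ℝ) * ∫ ω, Real.sin (X ω / N) ∂P) atTop (nhds L) ∧
      Tendsto (fun k : ℝ => ∫ ω, (if |X ω| ≤ k then X ω else 0) ∂P) atTop (nhds L) ∧
      Tendsto (fun k : ℝ => ∫ ω, max (min (X ω) k) (-k) ∂P) atTop (nhds L) ∧
      L = ∫ x in Set.Ioi (0 : ℝ),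
            (1 - (P.map X (Set.Iic x)).toReal - (P.map X (Set.Iic (-x))).toReal) := by
  obtain ⟨hp, σ, _, δ, hδ, h1, h2⟩ := hdom
  obtain ⟨L, a, b, c, d⟩ := core (P.map X) σ δ hδ h1 h2
  refine ⟨L, a.congr fun N => ?_, b.congr fun k => ?_, c.congr fun k => ?_, d⟩
  · rw [integral_map hX.aemeasurable (by fun_prop)]
  · rw [integral_map hX.aemeasurable]
    exact (Measurable.ite (measurableSet_le measurable_id.abs measurable_const)
      measurable_id measurable_const).aestronglyMeasurable
  · rw [integral_map hX.aemeasurable (by fun_prop)]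

end
end

section
/- Let n∈ℕ and let X_1,…,X_n be real random variables on a common probability space, each of whose laws lies in the strong attraction domain of a Cauchy distribution, with position parameters p_1,…,p_n (where the position parameter of X_i is p_i = lim_{k→∞} E[(X_i)_k], with (x)_k = max(min(x,k),−k)). Assume there exists δ>0 such that for all i≠j in {1,…,n}, P(|X_i| ≥ x and |X_j| ≥ x) = o(x^{−(1+δ)}) as x→+∞. Then the law of X_1+…+X_n lies in the strong attraction domain of a Cauchy distribution, and its position parameter equals p_1+…+p_n. -/
open MeasureTheory Filter Asymptotics

noncomputable section

lemma rpow_bigO_of_le {a b : ℝ} (h : a ≤ b) :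
    (fun x : ℝ => x ^ a) =O[atTop] (fun x : ℝ => x ^ b) := by
  refine IsBigO.of_bound 1 ?_
  filter_upwards [eventually_ge_atTop 1] with x hx
  have h0 : (0:ℝ) ≤ x := by linarith
  rw [Real.norm_of_nonneg (Real.rpow_nonneg h0 _), Real.norm_of_nonneg (Real.rpow_nonneg h0 _),
    one_mul]
  exact Real.rpow_le_rpow_of_exponent_le hx h

lemma rpow_littleO_of_lt {a b : ℝ} (h : a < b) :
    (fun x : ℝ => x ^ a) =o[atTop] (fun x : ℝ => x ^ b) := by
  have h0 : Tendsto (fun x : ℝ => x ^ (-(b - a))) atTop (nhds 0) :=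
    tendsto_rpow_neg_atTop (by linarith)
  refine (isLittleO_iff_tendsto' ?_).2 (h0.congr' ?_)
  · filter_upwards [eventually_gt_atTop 0] with x hx h1
    exact absurd h1 (Real.rpow_pos_of_pos hx _).ne'
  · filter_upwards [eventually_gt_atTop 0] with x hx
    rw [← Real.rpow_sub hx]
    congr 1
    ring

lemma half_ev {a : ℝ} (ha : a < 1) : ∀ᶠ x : ℝ in atTop, x ^ a ≤ x / 2 := by
  have := (rpow_littleO_of_lt ha).bound (show (0:ℝ) < 1/2 by norm_num)
  filter_upwards [this, eventually_ge_atTop 1] with x hx h1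
  have h0 : (0:ℝ) ≤ x := by linarith
  rw [Real.norm_of_nonneg (Real.rpow_nonneg h0 _), Real.norm_of_nonneg (Real.rpow_nonneg h0 _),
    Real.rpow_one] at hx
  linarith

lemma shift {g y : ℝ → ℝ} {c d : ℝ} (hd : 0 < d)
    (hg : (fun x => g x - c / x) =O[atTop] (fun x : ℝ => x ^ (-(1 + d))))
    (hy : ∀ᶠ x in atTop, |y x - x| ≤ x ^ (1 - d / 4)) :
    (fun x => g (y x) - c / x) =O[atTop] (fun x : ℝ => x ^ (-(1 + d / 4))) := by
  have hge : ∀ᶠ x : ℝ in atTop, x / 2 ≤ y x := by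
    filter_upwards [hy, half_ev (a := 1 - d / 4) (by linarith)] with x h1 h2
    have := neg_abs_le (y x - x)
    linarith
  have hyt : Tendsto y atTop atTop :=
    tendsto_atTop_mono' _ hge (tendsto_id.atTop_div_const (by norm_num))
  have h1 := hg.comp_tendsto hyt
  have h2 : ((fun x : ℝ => x ^ (-(1 + d))) ∘ y) =O[atTop] (fun x : ℝ => x ^ (-(1 + d))) := by
    refine IsBigO.of_bound ((1/2 : ℝ) ^ (-(1 + d))) ?_
    filter_upwards [hge, eventually_ge_atTop 1] with x hx h1
    have h0 : (0:ℝ) ≤ x := by linarith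
    have h0' : (0:ℝ) ≤ y x := by linarith
    simp only [Function.comp]
    rw [Real.norm_of_nonneg (Real.rpow_nonneg h0 _), Real.norm_of_nonneg (Real.rpow_nonneg h0' _),
      ← Real.mul_rpow (by norm_num) h0]
    exact Real.rpow_le_rpow_of_nonpos (by linarith) (by linarith) (by linarith)
  have h3 := (h1.trans h2).trans (rpow_bigO_of_le (show -(1+d) ≤ -(1+d/4) by linarith))
  have h4 : (fun x => c / y x - c / x) =O[atTop] (fun x : ℝ => x ^ (-(1 + d / 4))) := by
    refine IsBigO.of_bound (2 * |c|) ?_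
    filter_upwards [hge, hy, eventually_ge_atTop 1] with x hx hyx h1
    have h0 : (0:ℝ) < x := by linarith
    have h0' : (0:ℝ) < y x := by linarith
    rw [Real.norm_of_nonneg (Real.rpow_nonneg h0.le _), Real.norm_eq_abs]
    have e1 : c / y x - c / x = -(c * (y x - x)) / (y x * x) := by field_simp; ring
    have e2 : x ^ (-(1 + d / 4)) = x ^ (1 - d / 4) / (x * x) := by
      rw [show -(1 + d / 4) = (1 - d / 4) - 2 by ring, Real.rpow_sub h0]
      norm_num [sq]
    rw [e1, e2, abs_div, abs_neg, abs_mul, abs_of_pos (mul_pos h0' h0)]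
    rw [div_le_iff₀ (mul_pos h0' h0)]
    have e3 : 2 * |c| * (x ^ (1 - d / 4) / (x * x)) * (y x * x)
      = |c| * x ^ (1 - d / 4) * (2 * y x / x) := by field_simp
    rw [e3]
    have : 1 ≤ 2 * y x / x := by rw [le_div_iff₀ h0]; linarith
    calc |c| * |y x - x| ≤ |c| * x ^ (1 - d / 4) := by gcongr
      _ = |c| * x ^ (1 - d / 4) * 1 := by ring
      _ ≤ _ := by gcongr
  refine (h3.add h4).congr_left ?_
  intro x
  simp only [Function.comp]
  ring

lemma joint_pow {e : ℝ → ℝ} {d : ℝ} (hd : 0 < d) (hd1 : d ≤ 1)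
    (he : e =O[atTop] (fun x : ℝ => x ^ (-(1 + d)))) :
    (fun x => e (x ^ (1 - d / 4))) =O[atTop] (fun x : ℝ => x ^ (-(1 + d / 4))) := by
  have h1 := he.comp_tendsto (tendsto_rpow_atTop (show 0 < 1 - d / 4 by linarith))
  refine h1.trans (IsBigO.trans (IsBigO.of_bound 1 ?_)
    (rpow_bigO_of_le (show (1 - d / 4) * (-(1 + d)) ≤ -(1+d/4) by nlinarith)))
  filter_upwards [eventually_ge_atTop 1] with x h1
  simp only [Function.comp]
  rw [Real.rpow_mul (by linarith), one_mul]

lemma tail_add {g1 g2 gS e : ℝ → ℝ} {c1 c2 d : ℝ} (hd : 0 < d) (hd1 : d ≤ 1)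
    (h1 : (fun x => g1 x - c1 / x) =O[atTop] (fun x : ℝ => x ^ (-(1 + d))))
    (h2 : (fun x => g2 x - c2 / x) =O[atTop] (fun x : ℝ => x ^ (-(1 + d))))
    (he : e =O[atTop] (fun x : ℝ => x ^ (-(1 + d))))
    (hup : ∀ x b : ℝ, gS x ≤ g1 (x - b) + g2 (x - b) + e b)
    (hlow : ∀ x b : ℝ, 0 ≤ x → 0 ≤ b → g1 (x + b) + g2 (x + b) ≤ gS x + 2 * e b) :
    (fun x => gS x - (c1 + c2) / x) =O[atTop] (fun x : ℝ => x ^ (-(1 + d / 4))) := by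
  have hm : ∀ᶠ x : ℝ in atTop, |(x - x ^ (1 - d / 4)) - x| ≤ x ^ (1 - d / 4) := by
    filter_upwards [eventually_ge_atTop 0] with x hx
    rw [show (x - x ^ (1 - d / 4)) - x = -x ^ (1 - d / 4) by ring, abs_neg,
      abs_of_nonneg (Real.rpow_nonneg hx _)]
  have hpl : ∀ᶠ x : ℝ in atTop, |(x + x ^ (1 - d / 4)) - x| ≤ x ^ (1 - d / 4) := by
    filter_upwards [eventually_ge_atTop 0] with x hx
    rw [show (x + x ^ (1 - d / 4)) - x = x ^ (1 - d / 4) by ring,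
      abs_of_nonneg (Real.rpow_nonneg hx _)]
  have a1 := (shift hd h1 hm).norm_left
  have a2 := (shift hd h2 hm).norm_left
  have b1 := (shift hd h1 hpl).norm_left
  have b2 := (shift hd h2 hpl).norm_left
  have ee := ((joint_pow hd hd1 he).norm_left).const_mul_left 2
  refine IsBigO.trans ?_ ((((a1.add a2).add b1).add b2).add ee)
  refine IsBigO.of_bound 1 ?_
  filter_upwards [eventually_ge_atTop 0] with x hx
  have u := hup x (x ^ (1 - d / 4))
  have l := hlow x (x ^ (1 - d / 4)) hx (Real.rpow_nonneg hx _)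
  rw [one_mul]
  refine le_trans ?_ (le_abs_self _)
  simp only [Real.norm_eq_abs]
  rw [add_div]
  have t1 := abs_le.1 (le_refl |g1 (x - x ^ (1 - d / 4)) - c1 / x|)
  have t2 := abs_le.1 (le_refl |g2 (x - x ^ (1 - d / 4)) - c2 / x|)
  have t3 := abs_le.1 (le_refl |g1 (x + x ^ (1 - d / 4)) - c1 / x|)
  have t4 := abs_le.1 (le_refl |g2 (x + x ^ (1 - d / 4)) - c2 / x|)
  have t5 := abs_le.1 (le_refl |e (x ^ (1 - d / 4))|)
  have t6 := abs_nonneg (e (x ^ (1 - d / 4)))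
  rw [abs_le]
  constructor <;> linarith

section meas
variable {Ω : Type*} [MeasurableSpace Ω] (P : Measure Ω) [IsProbabilityMeasure P]

lemma scd_elim {X : Ω → ℝ} (hX : Measurable X) (h : StrongCauchyDomain (P.map X)) :
    ∃ c : ℝ, 0 ≤ c ∧ ∃ δ : ℝ, 0 < δ ∧
    (fun x => P.real {ω | x ≤ - X ω} - c / x) =O[atTop] (fun x : ℝ => x ^ (-(1 + δ))) ∧
    (fun x => P.real {ω | x < X ω} - c / x) =O[atTop] (fun x : ℝ => x ^ (-(1 + δ))) := by
  obtain ⟨_, σ, hσ, δ, hδ, h1, h2⟩ := h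
  refine ⟨σ / Real.pi, by positivity, δ, hδ, ?_, ?_⟩
  · have := (h1.comp_tendsto tendsto_neg_atTop_atBot).isBigO
    refine this.congr' ?_ ?_
    · filter_upwards [eventually_ge_atTop 0] with x hx
      simp only [Function.comp, abs_neg, abs_of_nonneg hx]
      rw [Measure.map_apply hX measurableSet_Iic, div_div]
      congr 3
      ext ω
      simp [le_neg]
    · filter_upwards [eventually_ge_atTop 0] with x hx
      simp only [Function.comp, abs_neg, abs_of_nonneg hx]
  · refine h2.isBigO.congr_left ?_
    intro x
    rw [Measure.map_apply hX measurableSet_Iic, div_div]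
    congr 1
    have := probReal_compl_eq_one_sub (μ := P) (hX (measurableSet_Iic (a := x)))
    rw [← measureReal_def, ← this]
    congr 1
    ext ω
    simp

lemma scd_intro {X : Ω → ℝ} (hX : Measurable X) (c : ℝ) (hc : 0 ≤ c) (δ : ℝ) (hδ : 0 < δ)
    (h1 : (fun x => P.real {ω | x ≤ - X ω} - c / x) =O[atTop] (fun x : ℝ => x ^ (-(1 + δ))))
    (h2 : (fun x => P.real {ω | x < X ω} - c / x) =O[atTop] (fun x : ℝ => x ^ (-(1 + δ)))) :
    StrongCauchyDomain (P.map X) := by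
  have hlt : -(1 + δ) < -(1 + δ / 2) := by linarith
  refine ⟨Measure.isProbabilityMeasure_map hX.aemeasurable, c * Real.pi, by positivity,
    δ / 2, by positivity, ?_, ?_⟩
  · have := (h1.trans_isLittleO (rpow_littleO_of_lt hlt)).comp_tendsto tendsto_neg_atBot_atTop
    refine this.congr' ?_ ?_
    · filter_upwards [eventually_le_atBot 0] with x hx
      simp only [Function.comp, abs_of_nonpos hx]
      rw [Measure.map_apply hX measurableSet_Iic, mul_comm c, mul_div_mul_left _ _ Real.pi_ne_zero,
        ← measureReal_def]
      congr 3
      ext ω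
      simp
    · filter_upwards [eventually_le_atBot 0] with x hx
      simp only [Function.comp, abs_of_nonpos hx]
  · refine (h2.trans_isLittleO (rpow_littleO_of_lt hlt)).congr_left ?_
    intro x
    rw [Measure.map_apply hX measurableSet_Iic, mul_comm c, mul_div_mul_left _ _ Real.pi_ne_zero]
    congr 1
    have := probReal_compl_eq_one_sub (μ := P) (hX (measurableSet_Iic (a := x)))
    rw [← measureReal_def, ← this]
    congr 1
    ext ω
    simp

lemma up_lt (X Y : Ω → ℝ) (x b : ℝ) :
    P.real {ω | x < X ω + Y ω} ≤ P.real {ω | x - b < X ω} + P.real {ω | x - b < Y ω}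
      + P.real {ω | b ≤ |X ω| ∧ b ≤ |Y ω|} := by
  refine le_trans (measureReal_mono (s₂ := ({ω | x - b < X ω} ∪ {ω | x - b < Y ω}) ∪
    {ω | b ≤ |X ω| ∧ b ≤ |Y ω|}) ?_) ((measureReal_union_le _ _).trans
      (by gcongr; exact measureReal_union_le _ _))
  intro ω hω
  simp only [Set.mem_ofPred_eq, Set.mem_union] at *
  by_contra! hc
  obtain ⟨⟨h1, h2⟩, h3⟩ := hc
  have := h3 ((by linarith : b ≤ X ω).trans (le_abs_self _))
  have := le_abs_self (Y ω)
  linarith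

lemma up_le (X Y : Ω → ℝ) (x b : ℝ) :
    P.real {ω | x ≤ X ω + Y ω} ≤ P.real {ω | x - b ≤ X ω} + P.real {ω | x - b ≤ Y ω}
      + P.real {ω | b ≤ |X ω| ∧ b ≤ |Y ω|} := by
  refine le_trans (measureReal_mono (s₂ := ({ω | x - b ≤ X ω} ∪ {ω | x - b ≤ Y ω}) ∪
    {ω | b ≤ |X ω| ∧ b ≤ |Y ω|}) ?_) ((measureReal_union_le _ _).trans
      (by gcongr; exact measureReal_union_le _ _))
  intro ω hω
  simp only [Set.mem_ofPred_eq, Set.mem_union] at *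
  by_contra! hc
  obtain ⟨⟨h1, h2⟩, h3⟩ := hc
  have := h3 ((by linarith : b ≤ X ω).trans (le_abs_self _))
  have := le_abs_self (Y ω)
  linarith

lemma low_gen (A B S J : Set Ω) (hB : MeasurableSet B) (h1 : A ⊆ S ∪ J) (h2 : B ⊆ S ∪ J)
    (h3 : A ∩ B ⊆ J) : P.real A + P.real B ≤ P.real S + 2 * P.real J := by
  rw [← measureReal_union_add_inter hB]
  have a1 : P.real (A ∪ B) ≤ P.real S + P.real J :=
    (measureReal_mono (Set.union_subset h1 h2)).trans (measureReal_union_le _ _)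
  have a2 : P.real (A ∩ B) ≤ P.real J := measureReal_mono h3
  linarith

lemma low_lt (X Y : Ω → ℝ) (hY : Measurable Y) (x b : ℝ) (hx : 0 ≤ x) (hb : 0 ≤ b) :
    P.real {ω | x + b < X ω} + P.real {ω | x + b < Y ω} ≤ P.real {ω | x < X ω + Y ω}
      + 2 * P.real {ω | b ≤ |X ω| ∧ b ≤ |Y ω|} := by
  apply low_gen
  · exact measurableSet_lt measurable_const hY
  all_goals
    intro ω hω
    simp only [Set.mem_ofPred_eq, Set.mem_union, Set.mem_inter_iff] at *
    have t1 := le_abs_self (X ω)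
    have t2 := le_abs_self (Y ω)
    have t3 := neg_le_abs (X ω)
    have t4 := neg_le_abs (Y ω)
    by_contra! hc
  · have := hc.2 (by linarith)
    linarith
  · have := hc.2 (by linarith)
    linarith
  · have := hc (by linarith)
    linarith

lemma low_le (X Y : Ω → ℝ) (hY : Measurable Y) (x b : ℝ) (hx : 0 ≤ x) (hb : 0 ≤ b) :
    P.real {ω | x + b ≤ X ω} + P.real {ω | x + b ≤ Y ω} ≤ P.real {ω | x ≤ X ω + Y ω}
      + 2 * P.real {ω | b ≤ |X ω| ∧ b ≤ |Y ω|} := by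
  apply low_gen
  · exact measurableSet_le measurable_const hY
  all_goals
    intro ω hω
    simp only [Set.mem_ofPred_eq, Set.mem_union, Set.mem_inter_iff] at *
    have t1 := le_abs_self (X ω)
    have t2 := le_abs_self (Y ω)
    have t3 := neg_le_abs (X ω)
    have t4 := neg_le_abs (Y ω)
    by_contra! hc
  · have := hc.2 (by linarith)
    linarith
  · have := hc.2 (by linarith)
    linarith
  · have := hc (by linarith)
    linarith

lemma abs_tail {X : Ω → ℝ} {c d : ℝ} (hd : 0 < d)
    (h1 : (fun x => P.real {ω | x ≤ - X ω} - c / x) =O[atTop] (fun x : ℝ => x ^ (-(1 + d))))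
    (h2 : (fun x => P.real {ω | x < X ω} - c / x) =O[atTop] (fun x : ℝ => x ^ (-(1 + d)))) :
    (fun x => P.real {ω | x ≤ |X ω|}) =O[atTop] (fun x : ℝ => x ^ (-1 : ℝ)) := by
  have key : ∀ g : ℝ → ℝ, (fun x => g x - c / x) =O[atTop] (fun x : ℝ => x ^ (-(1 + d))) →
      g =O[atTop] (fun x : ℝ => x ^ (-1 : ℝ)) := by
    intro g hg
    have a := hg.trans (rpow_bigO_of_le (show -(1 + d) ≤ -1 by linarith))
    have b : (fun x : ℝ => c / x) =O[atTop] (fun x : ℝ => x ^ (-1 : ℝ)) := by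
      refine ((isBigO_refl (fun x : ℝ => x ^ (-1 : ℝ)) atTop).const_mul_left c).congr_left ?_
      intro x
      rw [Real.rpow_neg_one, div_eq_mul_inv]
    refine (a.add b).congr_left ?_
    intro x; ring
  have k1 := key _ h1
  have k2 := (key _ h2).comp_tendsto
    (tendsto_id.atTop_div_const (show (0:ℝ) < 2 by norm_num) : Tendsto (fun x : ℝ => x / 2) _ _)
  have k3 : ((fun x : ℝ => x ^ (-1 : ℝ)) ∘ (fun x : ℝ => x / 2)) =O[atTop]
      (fun x : ℝ => x ^ (-1 : ℝ)) := by
    refine ((isBigO_refl (fun x : ℝ => x ^ (-1 : ℝ)) atTop).const_mul_left 2).congr_left ?_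
    intro x
    simp only [Function.comp, Real.rpow_neg_one]
    rw [inv_div]; ring
  refine IsBigO.trans ?_ (k1.add (k2.trans k3))
  refine IsBigO.of_bound 1 ?_
  filter_upwards [eventually_gt_atTop 0] with x hx
  simp only [Function.comp]
  rw [one_mul, Real.norm_of_nonneg measureReal_nonneg, Real.norm_of_nonneg (by positivity)]
  refine le_trans (measureReal_mono ?_) (measureReal_union_le _ _)
  intro ω hω
  simp only [Set.mem_ofPred_eq, Set.mem_union] at *
  rcases le_abs.1 hω with h | h
  · right; linarith
  · left; exact h

lemma trunc_bound (x y k b : ℝ) (hb : 0 ≤ b) (hbk : b ≤ k) :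
    |max (min (x + y) k) (-k) - max (min x k) (-k) - max (min y k) (-k)| ≤
      3 * k * (if b ≤ |x| ∧ b ≤ |y| then 1 else 0) + (2 * b * (if k - b ≤ |x| then 1 else 0)
        + 2 * b * (if k - b ≤ |y| then 1 else 0)) := by
  have T : ∀ z : ℝ, |max (min z k) (-k)| ≤ k := by
    intro z
    rw [abs_le]
    exact ⟨le_max_right _ _, max_le (min_le_right _ _) (by linarith)⟩
  have I : ∀ z : ℝ, |z| ≤ k → max (min z k) (-k) = z := by
    intro z hz
    rw [abs_le] at hz
    rw [min_eq_left hz.2, max_eq_left hz.1]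
  have L : ∀ z w : ℝ, |max (min z k) (-k) - max (min w k) (-k)| ≤ |z - w| := by
    intro z w
    refine (abs_max_sub_max_le_abs _ _ _).trans ?_
    have := abs_min_sub_min_le_max z k w k
    simpa using this
  have main : ∀ x y : ℝ, |y| < b →
     |max (min (x + y) k) (-k) - max (min x k) (-k) - max (min y k) (-k)| ≤
      (2 * b * (if k - b ≤ |x| then 1 else 0)) := by
    intro x y hy
    rw [I y (by linarith)]
    split_ifs with h
    · have := L (x + y) x
      rw [add_sub_cancel_left] at this
      have := abs_sub (max (min (x + y) k) (-k) - max (min x k) (-k)) y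
      linarith
    · push Not at h
      rw [I x (by linarith), I (x + y) ((abs_add_le _ _).trans (by linarith))]
      simp
  by_cases h : b ≤ |x| ∧ b ≤ |y|
  · rw [if_pos h]
    have n1 : (0:ℝ) ≤ (2 * b * (if k - b ≤ |x| then 1 else 0)) := by positivity
    have n2 : (0:ℝ) ≤ (2 * b * (if k - b ≤ |y| then 1 else 0)) := by positivity
    have a1 := abs_le.1 (T (x + y))
    have a2 := abs_le.1 (T x)
    have a3 := abs_le.1 (T y)
    rw [abs_le]
    constructor <;> linarith
  · rw [if_neg h]
    have n1 : (0:ℝ) ≤ (2 * b * (if k - b ≤ |x| then 1 else 0)) := by positivity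
    have n2 : (0:ℝ) ≤ (2 * b * (if k - b ≤ |y| then 1 else 0)) := by positivity
    by_cases hy : |y| < b
    · have := main x y hy
      linarith
    · have hx : |x| < b := by
        by_contra! hx
        exact h ⟨hx, not_lt.1 hy⟩
      have := main y x hx
      rw [add_comm y x, sub_right_comm] at this
      linarith

lemma integrable_trunc {X : Ω → ℝ} (hX : Measurable X) (k : ℝ) :
    Integrable (fun ω => max (min (X ω) k) (-k)) P := by
  refine Integrable.of_bound (C := |k|) (by fun_prop) (Eventually.of_forall fun ω => ?_)
  rw [Real.norm_eq_abs, abs_le]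
  refine ⟨(neg_le_neg (le_abs_self k)).trans (le_max_right _ _), max_le ((min_le_right _ _).trans (le_abs_self _)) (neg_le_abs _)⟩

lemma int_bound {X Y : Ω → ℝ} (hX : Measurable X) (hY : Measurable Y) (k b : ℝ) (hb : 0 ≤ b)
    (hbk : b ≤ k) :
    |∫ ω, max (min (X ω + Y ω) k) (-k) ∂P - ∫ ω, max (min (X ω) k) (-k) ∂P
      - ∫ ω, max (min (Y ω) k) (-k) ∂P| ≤ 3 * k * P.real {ω | b ≤ |X ω| ∧ b ≤ |Y ω|}
        + (2 * b * P.real {ω | k - b ≤ |X ω|} + 2 * b * P.real {ω | k - b ≤ |Y ω|}) := by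
  have hS : Measurable (fun ω => X ω + Y ω) := hX.add hY
  have mX : ∀ t, MeasurableSet {ω | t ≤ |X ω|} := fun t =>
    measurableSet_le measurable_const (by fun_prop)
  have mY : ∀ t, MeasurableSet {ω | t ≤ |Y ω|} := fun t =>
    measurableSet_le measurable_const (by fun_prop)
  have mJ : MeasurableSet {ω | b ≤ |X ω| ∧ b ≤ |Y ω|} := (mX b).inter (mY b)
  have hi : ∀ (s : Set Ω), MeasurableSet s → ∀ C : ℝ,
      Integrable (fun ω => C * s.indicator (fun _ => (1:ℝ)) ω) P := fun s hs C =>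
    ((integrable_const (1:ℝ)).indicator hs).const_mul C
  have hv : ∀ (s : Set Ω), MeasurableSet s → ∀ C : ℝ,
      ∫ ω, C * s.indicator (fun _ => (1:ℝ)) ω ∂P = C * P.real s := by
    intro s hs C
    rw [integral_const_mul]
    congr 1
    exact integral_indicator_one hs
  rw [← integral_sub (integrable_trunc P hS k) (integrable_trunc P hX k),
    ← integral_sub (f := fun ω => max (min (X ω + Y ω) k) (-k) - max (min (X ω) k) (-k))
      ((integrable_trunc P hS k).sub (integrable_trunc P hX k)) (integrable_trunc P hY k)]
  rw [← hv _ mJ, ← hv _ (mX _), ← hv _ (mY _), ← integral_add (hi _ (mX _) _) (hi _ (mY _) _),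
    ← integral_add (g := fun ω => 2 * b * {ω | k - b ≤ |X ω|}.indicator (fun _ => (1:ℝ)) ω +
        2 * b * {ω | k - b ≤ |Y ω|}.indicator (fun _ => (1:ℝ)) ω) (hi _ mJ _) ((hi _ (mX _) _).add (hi _ (mY _) _))]
  refine (abs_integral_le_integral_abs).trans ?_
  refine integral_mono ?_ ?_ ?_
  · exact (((integrable_trunc P hS k).sub (integrable_trunc P hX k)).sub
      (integrable_trunc P hY k)).abs
  · exact (hi _ mJ _).add ((hi _ (mX _) _).add (hi _ (mY _) _))
  · intro ω
    have := trunc_bound (X ω) (Y ω) k b hb hbk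
    simpa [Set.indicator_apply] using this

lemma two_var {X Y : Ω → ℝ} (hX : Measurable X) (hY : Measurable Y)
    (dX : StrongCauchyDomain (P.map X)) (dY : StrongCauchyDomain (P.map Y))
    {δ : ℝ} (hδ : 0 < δ)
    (hJ : (fun x : ℝ => P.real {ω | x ≤ |X ω| ∧ x ≤ |Y ω|})
        =o[atTop] (fun x : ℝ => x ^ (-(1 + δ)))) :
    StrongCauchyDomain (P.map (fun ω => X ω + Y ω)) ∧
    Tendsto (fun k : ℝ => ∫ ω, max (min (X ω + Y ω) k) (-k) ∂P - ∫ ω, max (min (X ω) k) (-k) ∂P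
      - ∫ ω, max (min (Y ω) k) (-k) ∂P) atTop (nhds 0) := by
  obtain ⟨c1, hc1, d1, hd1, x1, x2⟩ := scd_elim P hX dX
  obtain ⟨c2, hc2, d2, hd2, y1, y2⟩ := scd_elim P hY dY
  obtain ⟨d, hd, hdone, hdδ, hdd1, hdd2⟩ : ∃ d : ℝ, 0 < d ∧ d ≤ 1 ∧ d ≤ δ ∧ d ≤ d1 ∧ d ≤ d2 :=
    ⟨min (min δ 1) (min d1 d2), by positivity, by simp, by simp, by simp, by simp⟩
  have m1 := rpow_bigO_of_le (show -(1 + d1) ≤ -(1 + d) by linarith)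
  have m2 := rpow_bigO_of_le (show -(1 + d2) ≤ -(1 + d) by linarith)
  replace x1 := x1.trans m1
  replace x2 := x2.trans m1
  replace y1 := y1.trans m2
  replace y2 := y2.trans m2
  have e := hJ.isBigO.trans (rpow_bigO_of_le (show -(1 + δ) ≤ -(1 + d) by linarith))
  constructor
  · refine scd_intro P (hX.add hY) (c1 + c2) (by positivity) (d / 4) (by positivity) ?_ ?_
    · refine tail_add hd hdone x1 y1 e ?_ ?_
      · intro x b
        have := up_le P (fun ω => - X ω) (fun ω => - Y ω) x b
        simpa only [neg_add, abs_neg] using this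
      · intro x b hx hb
        have := low_le P (fun ω => - X ω) (fun ω => - Y ω) hY.neg x b hx hb
        simpa only [neg_add, abs_neg] using this
    · exact tail_add hd hdone x2 y2 e (up_lt P X Y) (low_lt P X Y hY)
  · have hJ' := joint_pow hd hdone e
    have half : Tendsto (fun k : ℝ => k / 2) atTop atTop :=
      tendsto_id.atTop_div_const (by norm_num)
    have half2 : ((fun x : ℝ => x ^ (-1 : ℝ)) ∘ (fun x : ℝ => x / 2)) =O[atTop]
        (fun x : ℝ => x ^ (-1 : ℝ)) := by
      refine ((isBigO_refl (fun x : ℝ => x ^ (-1 : ℝ)) atTop).const_mul_left 2).congr_left ?_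
      intro x
      simp only [Function.comp, Real.rpow_neg_one]
      rw [inv_div]; ring
    have tX := ((abs_tail P hd x1 x2).comp_tendsto half).trans half2
    have tY := ((abs_tail P hd y1 y2).comp_tendsto half).trans half2
    have hz : Tendsto (fun k : ℝ => k ^ (-(d / 4))) atTop (nhds 0) :=
      tendsto_rpow_neg_atTop (by positivity)
    have q1 : (fun k : ℝ => 3 * k * P.real {ω | k ^ (1 - d / 4) ≤ |X ω| ∧ k ^ (1 - d / 4) ≤ |Y ω|})
        =O[atTop] (fun k : ℝ => k ^ (-(d / 4))) := by
      have := ((isBigO_refl (fun x : ℝ => x) atTop).const_mul_left 3).mul hJ'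
      refine this.congr' (by rfl) ?_
      filter_upwards [eventually_gt_atTop 0] with k hk
      rw [show -(d / 4) = 1 + -(1 + d / 4) by ring, Real.rpow_add hk, Real.rpow_one]
    have q2 : ∀ Z : Ω → ℝ, ((fun x => P.real {ω | x ≤ |Z ω|}) ∘ (fun x : ℝ => x / 2)) =O[atTop]
        (fun x : ℝ => x ^ (-1 : ℝ)) →
        (fun k : ℝ => 2 * k ^ (1 - d / 4) * P.real {ω | k / 2 ≤ |Z ω|})
        =O[atTop] (fun k : ℝ => k ^ (-(d / 4))) := by
      intro Z hZ
      have := ((isBigO_refl (fun x : ℝ => x ^ (1 - d / 4)) atTop).const_mul_left 2).mul hZ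
      refine this.congr' (by rfl) ?_
      filter_upwards [eventually_gt_atTop 0] with k hk
      rw [show -(d / 4) = (1 - d / 4) + (-1) by ring, Real.rpow_add hk]
    have q := (q1.add ((q2 X tX).add (q2 Y tY))).trans_tendsto hz
    refine squeeze_zero_norm' ?_ q
    filter_upwards [half_ev (a := 1 - d / 4) (by linarith), eventually_ge_atTop 0] with k h1 h2
    rw [Real.norm_eq_abs]
    have hb0 : (0:ℝ) ≤ k ^ (1 - d / 4) := Real.rpow_nonneg h2 _
    refine (int_bound P hX hY k (k ^ (1 - d / 4)) hb0 (by linarith)).trans ?_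
    have mono : ∀ Z : Ω → ℝ, P.real {ω | k - k ^ (1 - d / 4) ≤ |Z ω|} ≤
        P.real {ω | k / 2 ≤ |Z ω|} := by
      intro Z
      refine measureReal_mono ?_
      intro ω hω
      simp only [Set.mem_ofPred_eq] at *
      linarith
    have mx := mul_le_mul_of_nonneg_left (mono X) (show 0 ≤ 2 * k ^ (1 - d / 4) by positivity)
    have my := mul_le_mul_of_nonneg_left (mono Y) (show 0 ≤ 2 * k ^ (1 - d / 4) by positivity)
    linarith

lemma joint_sum (n : ℕ) (X : Fin n → Ω → ℝ) (Y : Ω → ℝ) (δ : ℝ)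
    (h : ∀ i, (fun x : ℝ => P.real {ω | x ≤ |X i ω| ∧ x ≤ |Y ω|})
        =o[atTop] (fun x : ℝ => x ^ (-(1 + δ)))) :
    (fun x : ℝ => P.real {ω | x ≤ |∑ i, X i ω| ∧ x ≤ |Y ω|})
        =o[atTop] (fun x : ℝ => x ^ (-(1 + δ))) := by
  have hn : (0:ℝ) < n + 1 := by positivity
  have sc : Tendsto (fun k : ℝ => k / (n + 1 : ℝ)) atTop atTop :=
      tendsto_id.atTop_div_const hn
  have sc2 : ((fun x : ℝ => x ^ (-(1 + δ))) ∘ (fun x : ℝ => x / (n + 1 : ℝ))) =O[atTop]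
      (fun x : ℝ => x ^ (-(1 + δ))) := by
    refine ((isBigO_refl (fun x : ℝ => x ^ (-(1 + δ))) atTop).const_mul_left
      (((n + 1 : ℝ) ^ (-(1 + δ)))⁻¹)).congr' ?_ (by rfl)
    filter_upwards [eventually_ge_atTop 0] with x hx
    simp only [Function.comp]
    rw [Real.div_rpow hx hn.le, div_eq_inv_mul]
  have hs : (fun x : ℝ => ∑ i, P.real {ω | x / (n + 1 : ℝ) ≤ |X i ω| ∧ x / (n + 1 : ℝ) ≤ |Y ω|})
      =o[atTop] (fun x : ℝ => x ^ (-(1 + δ))) := by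
    have h0 := IsLittleO.sum (s := Finset.univ) (fun i _ =>
      ((h i).comp_tendsto sc).trans_isBigO sc2)
    refine h0.congr_left ?_
    intro x
    simp
  refine IsBigO.trans_isLittleO (IsBigO.of_bound 1 ?_) hs
  filter_upwards [eventually_gt_atTop 0] with x hx
  rw [one_mul, Real.norm_of_nonneg measureReal_nonneg,
    Real.norm_of_nonneg (Finset.sum_nonneg fun _ _ => measureReal_nonneg)]
  refine le_trans (measureReal_mono (s₂ := ⋃ i, {ω | x / (n + 1 : ℝ) ≤ |X i ω| ∧
    x / (n + 1 : ℝ) ≤ |Y ω|}) ?_) (measureReal_iUnion_fintype_le _)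
  intro ω hω
  simp only [Set.mem_ofPred_eq, Set.mem_iUnion] at *
  have hY : x / (n + 1 : ℝ) ≤ |Y ω| := (div_le_self hx.le (by linarith [hn, (Nat.cast_nonneg n : (0:ℝ) ≤ n)])).trans hω.2
  by_contra! hc
  have h1 : ∀ i, |X i ω| ≤ x / (n + 1 : ℝ) := fun i => by
    by_contra! h2
    exact absurd hY (not_le.2 (hc i h2.le))
  have h2 : |∑ i, X i ω| ≤ n * (x / (n + 1 : ℝ)) := by
    refine (Finset.abs_sum_le_sum_abs _ _).trans ((Finset.sum_le_sum fun i _ => h1 i).trans ?_)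
    simp
  have h3 : (n + 1 : ℝ) * (x / (n + 1 : ℝ)) = x := by field_simp
  have h4 : 0 < x / (n + 1 : ℝ) := by positivity
  linarith [hω.1]

end meas

/-- Lemma 5.3: if `X₁,…,X_n` lie in the strong attraction domain of Cauchy distributions with
position parameters `p₁,…,p_n` and their tails satisfy the joint smallness condition
`P(|X_i| ≥ x, |X_j| ≥ x) = o(x^(-(1+δ)))` for `i ≠ j`, then `X₁+…+X_n` lies in the strong
attraction domain and its position parameter is `p₁+…+p_n`. -/
theorem stmt_15 {Ω : Type*} [MeasurableSpace Ω] (P : Measure Ω) [IsProbabilityMeasure P]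
    (n : ℕ) (X : Fin n → Ω → ℝ) (hX : ∀ i, Measurable (X i))
    (hdom : ∀ i, StrongCauchyDomain (P.map (X i)))
    (p : Fin n → ℝ)
    (hp : ∀ i, Tendsto (fun k : ℝ => ∫ ω, max (min (X i ω) k) (-k) ∂P) atTop (nhds (p i)))
    (δ : ℝ) (hδ : 0 < δ)
    (htail : ∀ i j, i ≠ j →
      (fun x : ℝ => (P {ω | x ≤ |X i ω| ∧ x ≤ |X j ω|}).toReal)
        =o[atTop] (fun x : ℝ => x ^ (-(1 + δ)))) :
    StrongCauchyDomain (P.map (fun ω => ∑ i, X i ω)) ∧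
      Tendsto (fun k : ℝ => ∫ ω, max (min (∑ i, X i ω) k) (-k) ∂P) atTop
        (nhds (∑ i, p i)) := by
  induction n with
  | zero =>
    simp only [Finset.univ_eq_empty, Finset.sum_empty]
    constructor
    · refine scd_intro P measurable_const 0 le_rfl 1 one_pos ?_ ?_
      · refine (isBigO_zero _ _).congr' ?_ (by rfl)
        filter_upwards [eventually_gt_atTop 0] with x hx
        simp [not_le.2 hx]
      · refine (isBigO_zero _ _).congr' ?_ (by rfl)
        filter_upwards [eventually_gt_atTop 0] with x hx
        simp [not_lt.2 hx.le]
    · refine tendsto_const_nhds.congr' ?_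
      filter_upwards [eventually_gt_atTop 0] with x hx
      simp [hx.le]
  | succ n ih =>
    obtain ⟨i1, i2⟩ := ih (fun i => X i.castSucc) (fun i => hX _) (fun i => hdom _)
      (fun i => p i.castSucc) (fun i => hp _) (fun i j hij => htail _ _ (by simpa using hij))
    have hS : Measurable (fun ω => ∑ i : Fin n, X i.castSucc ω) :=
      Finset.measurable_sum _ (fun i _ => hX _)
    have hJ := joint_sum P n (fun i => X i.castSucc) (X (Fin.last n)) δ
      (fun i => htail _ _ (Fin.castSucc_lt_last i).ne)
    obtain ⟨a, b⟩ := two_var P hS (hX (Fin.last n)) i1 (hdom _) hδ hJ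
    simp only [Fin.sum_univ_castSucc]
    refine ⟨a, ?_⟩
    have := (b.add i2).add (hp (Fin.last n))
    rw [zero_add] at this
    refine this.congr ?_
    intro k
    ring

end
end
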